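/- Let u be a positive radial solution of -Δu = a(|x|)u^{p-1} on the annulus Ω = {R₁ < |x| < R₂} ⊂ ℝᴺ with zero Dirichlet data, let λ₁ be the optimal Hardy constant on Ω, ψ(θ) = (m-n)/N - cos(2θ) with m + n = N, and v(r,θ) = u(r)ψ(θ). If p - 2 > 2N/λ₁ then the quadratic form M(u,v) = ∫_Ω |∇v|² dx - (p-1)∫_Ω a|u|^{p-2}v² dx is strictly negative; in particular the second variation of the energy at u is negative in the direction v, so u is a degenerate-unstable (non-minimizing) critical point and symmetry breaking occurs. -/

import Mathlib

open Real Set MeasureTheory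

section Polar

variable {E : Type*} [NormedAddCommGroup E] [NormedSpace ℝ E] [FiniteDimensional ℝ E]
  [MeasurableSpace E] [BorelSpace E] [Nontrivial E] (μ : Measure E) [μ.IsAddHaarMeasure]

theorem integral_radial_mul_angular (F : ℝ → ℝ) (g : E → ℝ) :
    ∫ x, F ‖x‖ * g (‖x‖⁻¹ • x) ∂μ =
      (∫ r in Ioi (0 : ℝ), r ^ (Module.finrank ℝ E - 1) * F r) *
        ∫ ω : Metric.sphere (0 : E) 1, g ω ∂μ.toSphere := by
  calc
    ∫ x, F ‖x‖ * g (‖x‖⁻¹ • x) ∂μ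
      = ∫ x : ({(0)}ᶜ : Set E), F ‖x.1‖ * g (‖x.1‖⁻¹ • x.1) ∂(μ.comap (↑)) := by
      rw [integral_subtype_comap (measurableSet_singleton _).compl
          fun x => F ‖x‖ * g (‖x‖⁻¹ • x), restrict_compl_singleton]
    _ = ∫ y, g y.1 * F y.2 ∂μ.toSphere.prod (.volumeIoiPow (Module.finrank ℝ E - 1)) := by
      have := μ.measurePreserving_homeomorphUnitSphereProd.integral_comp
        (Homeomorph.measurableEmbedding _)
        (fun y : Metric.sphere (0 : E) 1 × Ioi (0 : ℝ) => g y.1 * F y.2)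
      simpa [mul_comm] using this
    _ = (∫ ω : Metric.sphere (0 : E) 1, g ω ∂μ.toSphere) *
        ∫ x : Ioi (0 : ℝ), F x ∂.volumeIoiPow (Module.finrank ℝ E - 1) :=
      integral_prod_mul (fun ω : Metric.sphere (0 : E) 1 => g ω) (fun x : Ioi (0 : ℝ) => F x)
    _ = _ := by
      rw [mul_comm]
      congr 1
      simp only [Measure.volumeIoiPow, ENNReal.ofReal]
      rw [integral_withDensity_eq_integral_smul,
        integral_subtype_comap measurableSet_Ioi
          fun a ↦ Real.toNNReal (a ^ (Module.finrank ℝ E - 1)) • F a,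
        setIntegral_congr_fun measurableSet_Ioi fun x hx ↦ ?_]
      · rw [NNReal.smul_def, Real.coe_toNNReal _ (pow_nonneg hx.out.le _), smul_eq_mul]
      · exact (measurable_subtype_coe.pow_const _).real_toNNReal

theorem setIntegral_annulus_radial_mul_angular {a b : ℝ} (ha : 0 < a) (F : ℝ → ℝ) (g : E → ℝ) :
    ∫ x in {x : E | a < ‖x‖ ∧ ‖x‖ < b}, F ‖x‖ * g (‖x‖⁻¹ • x) ∂μ =
      (∫ r in Ioo a b, r ^ (Module.finrank ℝ E - 1) * F r) *
        ∫ ω : Metric.sphere (0 : E) 1, g ω ∂μ.toSphere := by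
  have hmeas : MeasurableSet {x : E | a < ‖x‖ ∧ ‖x‖ < b} :=
    (measurableSet_lt measurable_const measurable_norm).inter
      (measurableSet_lt measurable_norm measurable_const)
  have h := integral_radial_mul_angular μ ((Ioo a b).indicator F) g
  rw [← integral_indicator hmeas]
  convert h using 1
  · refine integral_congr_ae (.of_forall fun x => ?_)
    by_cases hx : a < ‖x‖ ∧ ‖x‖ < b
    · simp [indicator, hx]
    · simp [indicator, hx]
  · congr 1
    rw [← inter_eq_right.2 (Ioo_subset_Ioi_self.trans (Ioi_subset_Ioi ha.le) : Ioo a b ⊆ Ioi 0),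
      ← setIntegral_indicator measurableSet_Ioo]
    refine integral_congr_ae (.of_forall fun x => ?_)
    by_cases hx : x ∈ Ioo a b
    · simp [indicator, hx.1, hx.2, ha.trans hx.1]
    · simp [indicator, hx]

theorem integrable_mul_exp_neg_norm_sq {P : E → ℝ} (hP : Continuous P) (C : ℝ) (k : ℕ)
    (hb : ∀ x, |P x| ≤ C * ‖x‖ ^ k) : Integrable (fun x => P x * exp (-‖x‖ ^ 2)) μ := by
  have h1 : Integrable (fun x : E => ‖x‖ ^ k * exp (-‖x‖ ^ 2)) μ := by
    rw [integrable_fun_norm_addHaar μ (f := fun r : ℝ => r ^ k * exp (-r ^ 2))]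
    have h := integrableOn_rpow_mul_exp_neg_mul_sq (b := 1) one_pos
      (s := ((Module.finrank ℝ E - 1 + k : ℕ) : ℝ))
      (lt_of_lt_of_le (by norm_num) (Nat.cast_nonneg _))
    refine h.congr_fun (fun r _ => ?_) measurableSet_Ioi
    simp only [rpow_natCast, smul_eq_mul, neg_mul, one_mul]
    rw [pow_add]; ring
  refine (h1.const_mul C).mono' (by fun_prop) (.of_forall fun x => ?_)
  rw [norm_mul, norm_eq_abs, norm_eq_abs, abs_of_pos (exp_pos _), ← mul_assoc]
  exact mul_le_mul_of_nonneg_right (hb x) (exp_pos _).le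

end Polar

theorem integral_pow_mul_exp_neg_sq (k : ℕ) :
    ∫ r in Ioi (0 : ℝ), r ^ k * exp (-r ^ 2) = 1 / 2 * Gamma ((k + 1) / 2) := by
  rw [← integral_rpow_mul_exp_neg_rpow two_pos
    (lt_of_lt_of_le (by norm_num) (Nat.cast_nonneg k))]
  simp

section DiagonalQuadratic

variable {ι : Type*} [Fintype ι] (c : ι → ℝ)

theorem abs_sum_mul_sq_le (x : EuclideanSpace ℝ ι) :
    |∑ i, c i * x i ^ 2| ≤ (∑ i, |c i|) * ‖x‖ ^ 2 := by
  rw [Finset.sum_mul]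
  refine (Finset.abs_sum_le_sum_abs _ _).trans (Finset.sum_le_sum fun i _ => ?_)
  rw [abs_mul, abs_of_nonneg (sq_nonneg (x i))]
  exact mul_le_mul_of_nonneg_left
    (sq_le_sq.2 (by rw [abs_norm]; exact PiLp.norm_apply_le x i)) (abs_nonneg _)

theorem hasGradientAt_sum_mul_sq (x : EuclideanSpace ℝ ι) :
    HasGradientAt (fun x : EuclideanSpace ℝ ι => ∑ i, c i * x i ^ 2)
      (WithLp.toLp 2 fun i => 2 * (c i * x i)) x := by
  rw [hasGradientAt_iff_hasFDerivAt]
  have h : ∀ i ∈ Finset.univ, HasFDerivAt (fun x : EuclideanSpace ℝ ι => c i * x i ^ 2)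
      ((2 * (c i * x i)) • EuclideanSpace.proj (𝕜 := ℝ) i) x := fun i _ => by
    have h0 : HasFDerivAt (fun x : EuclideanSpace ℝ ι => x i)
      (EuclideanSpace.proj (𝕜 := ℝ) i : EuclideanSpace ℝ ι →L[ℝ] ℝ) x :=
      (EuclideanSpace.proj (𝕜 := ℝ) i : EuclideanSpace ℝ ι →L[ℝ] ℝ).hasFDerivAt
    convert! (h0.pow 2).const_mul (c i) using 1
    ext y; simp; ring
  convert! HasFDerivAt.fun_sum h using 1
  ext y
  simp [PiLp.inner_apply, mul_comm]

theorem integral_sq_sum_mul_sq_mul_gaussian [Nonempty ι] (hc : ∑ i, c i = 0) :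
    ∫ x : EuclideanSpace ℝ ι, (∑ i, c i * x i ^ 2) ^ 2 * exp (-‖x‖ ^ 2) =
      ∫ x : EuclideanSpace ℝ ι, (∑ i, c i ^ 2 * x i ^ 2) * exp (-‖x‖ ^ 2) := by
  classical
  set q : EuclideanSpace ℝ ι → ℝ := fun x => ∑ i, c i * x i ^ 2 with hq
  set K := ∑ i, |c i|
  have hqc : Continuous q := by fun_prop
  have hqb (x) : |q x| ≤ K * ‖x‖ ^ 2 := abs_sum_mul_sq_le c x
  have hxb (x : EuclideanSpace ℝ ι) (i) : |x i| ≤ ‖x‖ := PiLp.norm_apply_le x i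
  have i1 : Integrable (fun x => q x * exp (-‖x‖ ^ 2)) :=
    integrable_mul_exp_neg_norm_sq _ hqc K 2 hqb
  have i2 (i) : Integrable (fun x : EuclideanSpace ℝ ι => x i ^ 2 * exp (-‖x‖ ^ 2)) :=
    integrable_mul_exp_neg_norm_sq _ (by fun_prop) 1 2 fun x => by
      rw [abs_pow, one_mul]; gcongr; exact hxb x i
  have i3 (i) : Integrable (fun x : EuclideanSpace ℝ ι => (x i ^ 2 * q x) * exp (-‖x‖ ^ 2)) :=
    integrable_mul_exp_neg_norm_sq _ (by fun_prop) K 4 fun x => by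
      rw [abs_mul, abs_pow]
      calc _ ≤ ‖x‖ ^ 2 * (K * ‖x‖ ^ 2) := by
            gcongr
            exacts [hxb x i, hqb x]
        _ = _ := by ring
  have i4 (i) : Integrable (fun x : EuclideanSpace ℝ ι => (x i * q x) * exp (-‖x‖ ^ 2)) :=
    integrable_mul_exp_neg_norm_sq _ (by fun_prop) K 3 fun x => by
      rw [abs_mul]
      calc _ ≤ ‖x‖ * (K * ‖x‖ ^ 2) := by
            gcongr
            exacts [hxb x i, hqb x]
        _ = _ := by ring
  have i5 (i) : Integrable (fun x : EuclideanSpace ℝ ι =>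
      (q x + 2 * c i * x i ^ 2 - 2 * (x i ^ 2 * q x)) * exp (-‖x‖ ^ 2)) := by
    refine ((i1.add ((i2 i).const_mul (2 * c i))).sub ((i3 i).const_mul 2)).congr
      (.of_forall fun x => ?_)
    simp; ring
  have key (i) : ∫ x : EuclideanSpace ℝ ι,
      (q x + 2 * c i * x i ^ 2 - 2 * (x i ^ 2 * q x)) * exp (-‖x‖ ^ 2) = 0 := by
    have hld (x : EuclideanSpace ℝ ι) :
        HasLineDerivAt ℝ (fun x : EuclideanSpace ℝ ι => (x i * q x) * exp (-‖x‖ ^ 2))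
          ((q x + 2 * c i * x i ^ 2 - 2 * (x i ^ 2 * q x)) * exp (-‖x‖ ^ 2)) x
          (EuclideanSpace.single i 1) := by
      have h1 := ((EuclideanSpace.proj (𝕜 := ℝ) i : EuclideanSpace ℝ ι →L[ℝ] ℝ).hasFDerivAt
        (x := x)).hasLineDerivAt (EuclideanSpace.single i 1)
      have h2 := (hasGradientAt_sum_mul_sq c x).hasFDerivAt.hasLineDerivAt
        (EuclideanSpace.single i 1)
      have h3 := ((hasStrictFDerivAt_norm_sq x).hasFDerivAt.neg.exp).hasLineDerivAt
        (EuclideanSpace.single i 1)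
      unfold HasLineDerivAt at h1 h2 h3 ⊢
      convert! (h1.mul h2).mul h3 using 1
      simp [hq, PiLp.inner_apply]
      ring
    have h := integral_bilinear_hasLineDerivAt_right_eq_neg_left_of_integrable
      (μ := (volume : Measure (EuclideanSpace ℝ ι)))
      (f := fun x : EuclideanSpace ℝ ι => (x i * q x) * exp (-‖x‖ ^ 2))
      (f' := fun x => (q x + 2 * c i * x i ^ 2 - 2 * (x i ^ 2 * q x)) * exp (-‖x‖ ^ 2))
      (g := fun _ => (1 : ℝ)) (g' := fun _ => 0) (v := EuclideanSpace.single i 1)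
      (B := ContinuousLinearMap.mul ℝ ℝ) (by simpa using i5 i) (by simp) (by simpa using i4 i)
      (fun x _ => hld x) (fun x _ => by
        unfold HasLineDerivAt; exact hasDerivAt_const _ _)
    simp at h
    linarith
  have hsum : ∫ x : EuclideanSpace ℝ ι, ∑ i, c i *
      ((q x + 2 * c i * x i ^ 2 - 2 * (x i ^ 2 * q x)) * exp (-‖x‖ ^ 2)) = 0 := by
    rw [integral_finsetSum _ fun i _ => (i5 i).const_mul _]
    simp [integral_const_mul, key]
  have hpt (x : EuclideanSpace ℝ ι) : ∑ i, c i *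
      ((q x + 2 * c i * x i ^ 2 - 2 * (x i ^ 2 * q x)) * exp (-‖x‖ ^ 2)) =
      2 * ((∑ i, c i ^ 2 * x i ^ 2) * exp (-‖x‖ ^ 2)) - 2 * (q x ^ 2 * exp (-‖x‖ ^ 2)) := by
    have : ∀ i, c i *
      ((q x + 2 * c i * x i ^ 2 - 2 * (x i ^ 2 * q x)) * exp (-‖x‖ ^ 2)) =
      c i * (q x * exp (-‖x‖ ^ 2)) + c i ^ 2 * x i ^ 2 * (2 * exp (-‖x‖ ^ 2)) -
        c i * x i ^ 2 * (2 * q x * exp (-‖x‖ ^ 2)) := fun i => by ring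
    simp only [this, Finset.sum_sub_distrib, Finset.sum_add_distrib, ← Finset.sum_mul, hc]
    rw [← show q x = ∑ i, c i * x i ^ 2 from rfl]
    ring
  simp only [hpt] at hsum
  have j1 : Integrable (fun x : EuclideanSpace ℝ ι =>
      (∑ i, c i ^ 2 * x i ^ 2) * exp (-‖x‖ ^ 2)) :=
    integrable_mul_exp_neg_norm_sq _ (by fun_prop) _ 2 (abs_sum_mul_sq_le fun i => c i ^ 2)
  have j2 : Integrable (fun x : EuclideanSpace ℝ ι => q x ^ 2 * exp (-‖x‖ ^ 2)) :=
    integrable_mul_exp_neg_norm_sq _ (by fun_prop) (K ^ 2) 4 fun x => by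
      rw [abs_pow]
      calc _ ≤ (K * ‖x‖ ^ 2) ^ 2 := by gcongr; exact hqb x
        _ = _ := by ring
  rw [integral_sub (j1.const_mul 2) (j2.const_mul 2), integral_const_mul, integral_const_mul]
    at hsum
  linarith

theorem sum_mul_sq_smul (t : ℝ) (x : EuclideanSpace ℝ ι) :
    ∑ i, c i * (t • x) i ^ 2 = t ^ 2 * ∑ i, c i * x i ^ 2 := by
  rw [Finset.mul_sum]
  refine Finset.sum_congr rfl fun i _ => ?_
  simp; ring

theorem integral_sphere_sum_sq_mul_sq [Nonempty ι] (hc : ∑ i, c i = 0) :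
    2 * ∫ ω : Metric.sphere (0 : EuclideanSpace ℝ ι) 1,
        (∑ i, c i ^ 2 * (ω : EuclideanSpace ℝ ι) i ^ 2)
        ∂(volume : Measure (EuclideanSpace ℝ ι)).toSphere =
      (Fintype.card ι + 2) * ∫ ω : Metric.sphere (0 : EuclideanSpace ℝ ι) 1,
        (∑ i, c i * (ω : EuclideanSpace ℝ ι) i ^ 2) ^ 2
        ∂(volume : Measure (EuclideanSpace ℝ ι)).toSphere := by
  have h := integral_sq_sum_mul_sq_mul_gaussian c hc
  have e1 (x : EuclideanSpace ℝ ι) : (∑ i, c i * x i ^ 2) ^ 2 * exp (-‖x‖ ^ 2) =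
      (fun r : ℝ => r ^ 4 * exp (-r ^ 2)) ‖x‖ *
        (fun y : EuclideanSpace ℝ ι => (∑ i, c i * y i ^ 2) ^ 2) (‖x‖⁻¹ • x) := by
    rcases eq_or_ne x 0 with rfl | hx
    · simp
    · have := norm_ne_zero_iff.2 hx
      simp only [sum_mul_sq_smul]
      field_simp
  have e2 (x : EuclideanSpace ℝ ι) : (∑ i, c i ^ 2 * x i ^ 2) * exp (-‖x‖ ^ 2) =
      (fun r : ℝ => r ^ 2 * exp (-r ^ 2)) ‖x‖ *
        (fun y : EuclideanSpace ℝ ι => (∑ i, c i ^ 2 * y i ^ 2)) (‖x‖⁻¹ • x) := by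
    rcases eq_or_ne x 0 with rfl | hx
    · simp
    · have := norm_ne_zero_iff.2 hx
      simp only [sum_mul_sq_smul (fun i => c i ^ 2)]
      field_simp
  rw [integral_congr_ae (.of_forall e1), integral_congr_ae (.of_forall e2),
    integral_radial_mul_angular volume (fun r : ℝ => r ^ 4 * exp (-r ^ 2))
      (fun y : EuclideanSpace ℝ ι => (∑ i, c i * y i ^ 2) ^ 2),
    integral_radial_mul_angular volume (fun r : ℝ => r ^ 2 * exp (-r ^ 2))
      (fun y : EuclideanSpace ℝ ι => ∑ i, c i ^ 2 * y i ^ 2)] at h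
  simp only [← mul_assoc, ← pow_add, integral_pow_mul_exp_neg_sq, finrank_euclideanSpace] at h
  have hN : 1 ≤ Fintype.card ι := Fintype.card_pos
  have g1 : (((Fintype.card ι - 1 + 4 : ℕ) : ℝ) + 1) / 2 = (Fintype.card ι + 2) / 2 + 1 := by
    push_cast [hN]; ring
  have g2 : (((Fintype.card ι - 1 + 2 : ℕ) : ℝ) + 1) / 2 = (Fintype.card ι + 2) / 2 := by
    push_cast [hN]; ring
  have hpos : (0 : ℝ) < (Fintype.card ι + 2) / 2 := by positivity
  rw [g1, g2, Gamma_add_one hpos.ne'] at h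
  have hG := Gamma_pos_of_pos hpos
  refine mul_left_cancel₀ hG.ne' ?_
  linear_combination (-4) * h

theorem integral_sphere_sq_sum_mul_sq_pos [Nonempty ι] {i : ι} (hi : c i ≠ 0) :
    0 < ∫ ω : Metric.sphere (0 : EuclideanSpace ℝ ι) 1,
        (∑ i, c i * (ω : EuclideanSpace ℝ ι) i ^ 2) ^ 2
        ∂(volume : Measure (EuclideanSpace ℝ ι)).toSphere := by
  classical
  refine Continuous.integral_pos_of_hasCompactSupport_nonneg_nonzero
    (x := ⟨EuclideanSpace.single i 1, by simp⟩) (by fun_prop) (.of_compactSpace _)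
    (fun _ => sq_nonneg _) ?_
  simpa [Pi.single_apply] using hi

end DiagonalQuadratic

section Gradient

theorem hasFDerivAt_norm_of_ne_zero {E : Type*} [NormedAddCommGroup E] [InnerProductSpace ℝ E]
    {x : E} (hx : x ≠ 0) : HasFDerivAt (fun y : E => ‖y‖) (‖x‖⁻¹ • innerSL ℝ x) x := by
  have h := (hasStrictFDerivAt_norm_sq x).hasFDerivAt.sqrt (pow_ne_zero 2 (norm_ne_zero_iff.2 hx))
  simp only [sqrt_sq (norm_nonneg _)] at h
  convert! h using 1
  ext y
  have := norm_ne_zero_iff.2 hx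
  simp
  field_simp

theorem norm_sq_gradient_radial {E : Type*} [NormedAddCommGroup E] [InnerProductSpace ℝ E]
    [CompleteSpace E] {f : ℝ → ℝ} {f' : ℝ} {x : E} (hx : x ≠ 0) (hf : HasDerivAt f f' ‖x‖) :
    ‖gradient (fun y : E => f ‖y‖) x‖ ^ 2 = f' ^ 2 := by
  have h : HasGradientAt (fun y : E => f ‖y‖) ((f' * ‖x‖⁻¹) • x) x := by
    rw [hasGradientAt_iff_hasFDerivAt]
    convert! hf.comp_hasFDerivAt x (hasFDerivAt_norm_of_ne_zero hx) using 1
    ext y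
    simp
    ring
  have := norm_ne_zero_iff.2 hx
  rw [h.gradient, norm_smul, mul_pow, norm_eq_abs, sq_abs]
  field_simp

theorem norm_sq_gradient_radial_mul_angular {ι : Type*} [Fintype ι] (c : ι → ℝ) {u : ℝ → ℝ}
    {u' : ℝ} {x : EuclideanSpace ℝ ι} (hx : x ≠ 0) (hu : HasDerivAt u u' ‖x‖) :
    ‖gradient (fun y : EuclideanSpace ℝ ι => u ‖y‖ * ((∑ i, c i * y i ^ 2) / ‖y‖ ^ 2)) x‖ ^ 2 =
      u' ^ 2 * (∑ i, c i * (‖x‖⁻¹ • x) i ^ 2) ^ 2 + u ‖x‖ ^ 2 / ‖x‖ ^ 2 *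
        (4 * ∑ i, c i ^ 2 * (‖x‖⁻¹ • x) i ^ 2 - 4 * (∑ i, c i * (‖x‖⁻¹ • x) i ^ 2) ^ 2) := by
  have hr := norm_ne_zero_iff.2 hx
  set q := ∑ i, c i * x i ^ 2 with hq
  set r := ‖x‖ with hrdef
  set y : EuclideanSpace ℝ ι := WithLp.toLp 2 fun i => c i * x i with hy
  have hxy : inner ℝ x y = q := by
    simp only [hq, hy, PiLp.inner_apply]
    exact Finset.sum_congr rfl fun i _ => by simp; ring
  have hyy : ‖y‖ ^ 2 = ∑ i, c i ^ 2 * x i ^ 2 := by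
    simp [EuclideanSpace.real_norm_sq_eq, hy, mul_pow]
  have h : HasGradientAt
      (fun y : EuclideanSpace ℝ ι => u ‖y‖ * ((∑ i, c i * y i ^ 2) / ‖y‖ ^ 2))
      (((u' / r ^ 2 - 2 * u r / r ^ 3) / r * q) • x + (2 * u r / r ^ 2) • y) x := by
    rw [hasGradientAt_iff_hasFDerivAt]
    have h1 : HasDerivAt (fun t => u t / t ^ 2) (u' / r ^ 2 - 2 * u r / r ^ 3) r := by
      convert! hu.div (hasDerivAt_pow 2 r) (pow_ne_zero 2 hr) using 1
      field_simp
      simp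
      ring
    have h2 := (h1.comp_hasFDerivAt x (hasFDerivAt_norm_of_ne_zero hx)).mul
      (hasGradientAt_sum_mul_sq c x).hasFDerivAt
    convert! h2 using 1
    · ext z; simp; ring
    · have h3 : (WithLp.toLp 2 fun i => 2 * (c i * x i)) = (2 : ℝ) • y := by
        ext i; simp [hy]
      rw [h3]
      ext z
      simp
      rw [← hq, ← hrdef]
      field_simp
      ring
  rw [h.gradient, norm_add_sq_real, norm_smul, norm_smul, mul_pow, mul_pow, norm_eq_abs, sq_abs,
    norm_eq_abs, sq_abs, inner_smul_left, inner_smul_right, hxy, hyy, sum_mul_sq_smul,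
    sum_mul_sq_smul (fun i => c i ^ 2), ← hq, ← hrdef]
  simp only [conj_trivial]
  field_simp
  ring

end Gradient

section Annulus

variable {E : Type*} [NormedAddCommGroup E]

theorem ContinuousOn.integrableOn_annulus [NormedSpace ℝ E] [FiniteDimensional ℝ E]
    [MeasurableSpace E] [BorelSpace E] {μ : Measure E} [IsFiniteMeasureOnCompacts μ] {a b : ℝ}
    {f : E → ℝ} (hf : ContinuousOn f {x : E | ‖x‖ ∈ Icc a b}) :
    IntegrableOn f {x : E | a < ‖x‖ ∧ ‖x‖ < b} μ := by
  have hK : IsCompact {x : E | ‖x‖ ∈ Icc a b} :=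
    (isCompact_closedBall (0 : E) b).of_isClosed_subset (isClosed_Icc.preimage continuous_norm)
      fun x hx => by simpa using hx.2
  exact (hf.integrableOn_compact hK).mono_set fun x hx => ⟨hx.1.le, hx.2.le⟩

theorem ContinuousOn.comp_norm {a b : ℝ} {f : ℝ → ℝ} (hf : ContinuousOn f (Icc a b)) :
    ContinuousOn (fun x : E => f ‖x‖) {x : E | ‖x‖ ∈ Icc a b} :=
  hf.comp continuous_norm.continuousOn fun _ hx => hx

end Annulus

/-- A `C¹` function vanishing on `(-∞, ε]`, with slope in `[0, 1]`, within `2ε` of the identity on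
`[0, ∞)`. -/
noncomputable def smoothShrink (ε s : ℝ) : ℝ := ∫ t in (0)..s, max 0 (min 1 (t / ε - 1))

section SmoothShrink

variable {ε : ℝ}

theorem continuous_smoothShrink_integrand :
    Continuous fun t : ℝ => max 0 (min 1 (t / ε - 1)) := by fun_prop

theorem hasDerivAt_smoothShrink (s : ℝ) :
    HasDerivAt (smoothShrink ε) (max 0 (min 1 (s / ε - 1))) s :=
  continuous_smoothShrink_integrand.integral_hasStrictDerivAt 0 s |>.hasDerivAt

theorem contDiff_smoothShrink : ContDiff ℝ 1 (smoothShrink ε) := by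
  rw [contDiff_one_iff_deriv]
  refine ⟨fun s => (hasDerivAt_smoothShrink s).differentiableAt, ?_⟩
  rw [funext fun s => (hasDerivAt_smoothShrink (ε := ε) s).deriv]
  exact continuous_smoothShrink_integrand

theorem smoothShrink_eq_zero (hε : 0 < ε) {s : ℝ} (hs : s ≤ ε) : smoothShrink ε s = 0 := by
  unfold smoothShrink
  rw [intervalIntegral.integral_congr (g := fun _ => 0)]
  · simp
  · intro t ht
    have : t ≤ ε := by
      rcases mem_uIcc.1 ht with h | h <;> linarith [h.2]
    have : t / ε ≤ 1 := (div_le_one hε).2 this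
    exact max_eq_left ((min_le_right _ _).trans (by linarith))

theorem smoothShrink_nonneg {s : ℝ} (hs : 0 ≤ s) : 0 ≤ smoothShrink ε s :=
  intervalIntegral.integral_nonneg hs fun _ _ => le_max_left _ _

theorem sub_le_smoothShrink (hε : 0 < ε) {s : ℝ} (hs : 0 ≤ s) : s - 2 * ε ≤ smoothShrink ε s := by
  rcases le_total s (2 * ε) with h | h
  · linarith [smoothShrink_nonneg (ε := ε) hs]
  · have hi (x y : ℝ) : IntervalIntegrable (fun t : ℝ => max 0 (min 1 (t / ε - 1))) volume x y :=
      continuous_smoothShrink_integrand.intervalIntegrable _ _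
    have h1 : smoothShrink ε s = smoothShrink ε (2 * ε) +
        ∫ t in (2 * ε)..s, max 0 (min 1 (t / ε - 1)) :=
      (intervalIntegral.integral_add_adjacent_intervals (hi _ _) (hi _ _)).symm
    have h2 : ∫ t in (2 * ε)..s, max 0 (min 1 (t / ε - 1)) = ∫ t in (2 * ε)..s, (1 : ℝ) := by
      refine intervalIntegral.integral_congr fun t ht => ?_
      rw [uIcc_of_le h] at ht
      have : 2 ≤ t / ε := (le_div_iff₀ hε).2 ht.1
      rw [min_eq_left (by linarith), max_eq_right zero_le_one]
    rw [h1, h2]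
    simp
    exact smoothShrink_nonneg (by linarith)

end SmoothShrink

theorem ContDiffOn.hasDerivAt_derivWithin_Icc {u : ℝ → ℝ} {a b r : ℝ}
    (hu : ContDiffOn ℝ 1 u (Icc a b)) (hr : r ∈ Ioo a b) :
    HasDerivAt u (derivWithin u (Icc a b) r) r :=
  ((hu.differentiableOn one_ne_zero r (Ioo_subset_Icc_self hr)).hasDerivWithinAt).hasDerivAt
    (Icc_mem_nhds hr.1 hr.2)

theorem integral_pow_mul_derivWithin_sq {a b : ℝ} (ha : 0 < a) (hab : a < b) {u f : ℝ → ℝ} {k : ℕ}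
    (hu : ContDiffOn ℝ 2 u (Icc a b)) (hf : ContinuousOn f (Icc a b)) (hua : u a = 0)
    (hub : u b = 0)
    (hODE : ∀ r ∈ Ioo a b, -(deriv (deriv u) r) - (k : ℝ) / r * deriv u r = f r) :
    ∫ r in Ioo a b, r ^ k * derivWithin u (Icc a b) r ^ 2 = ∫ r in Ioo a b, r ^ k * (f r * u r) := by
  set u' := derivWithin u (Icc a b)
  have hu1 : ContDiffOn ℝ 1 u (Icc a b) := hu.of_le one_le_two
  have hc : ContinuousOn u (Icc a b) := hu.continuousOn
  have hc' : ContinuousOn u' (Icc a b) :=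
    hu1.continuousOn_derivWithin (uniqueDiffOn_Icc hab) le_rfl
  have hd (r) (hr : r ∈ Ioo a b) : HasDerivAt u (u' r) r := hu1.hasDerivAt_derivWithin_Icc hr
  have hd' (r) (hr : r ∈ Ioo a b) : HasDerivAt u' (-(k : ℝ) / r * u' r - f r) r := by
    have h1 : ContDiffOn ℝ 1 (deriv u) (Ioo a b) :=
      (hu.mono Ioo_subset_Icc_self).deriv_of_isOpen isOpen_Ioo (by norm_num)
    have h2 : HasDerivAt (deriv u) (deriv (deriv u) r) r :=
      ((h1.differentiableOn one_ne_zero r hr).differentiableAt (isOpen_Ioo.mem_nhds hr)).hasDerivAt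
    have h3 : u' =ᶠ[nhds r] deriv u := by
      filter_upwards [isOpen_Ioo.mem_nhds hr] with s hs using (hd s hs).deriv.symm
    convert! h2.congr_of_eventuallyEq h3 using 1
    rw [h3.eq_of_nhds]
    have := hODE r hr
    rw [neg_div]
    linarith
  have i1 : IntegrableOn (fun r => r ^ k * u' r ^ 2) (Icc a b) :=
    ContinuousOn.integrableOn_Icc (by fun_prop)
  have i2 : IntegrableOn (fun r => r ^ k * (f r * u r)) (Icc a b) :=
    ContinuousOn.integrableOn_Icc (by fun_prop)
  have h := intervalIntegral.integral_eq_sub_of_hasDerivAt_of_le hab.le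
    (f := fun r => r ^ k * (u r * u' r)) (f' := fun r => r ^ k * u' r ^ 2 - r ^ k * (f r * u r))
    (by fun_prop) (fun r hr => ?_) ?_
  · rw [intervalIntegral.integral_of_le hab.le, integral_Ioc_eq_integral_Ioo,
      integral_sub (i1.mono_set Ioo_subset_Icc_self) (i2.mono_set Ioo_subset_Icc_self)] at h
    simp only [hua, hub] at h
    linarith
  · have hr0 : r ≠ 0 := (ha.trans hr.1).ne'
    convert! (hasDerivAt_pow k r).mul ((hd r hr).mul (hd' r hr)) using 1
    rcases k with _ | k
    · simp; ring
    · simp [pow_succ]; field_simp; ring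
  · rw [intervalIntegrable_iff_integrableOn_Icc_of_le hab.le]
    exact i1.sub i2

theorem hardy_radial {E : Type*} [NormedAddCommGroup E] [InnerProductSpace ℝ E]
    [FiniteDimensional ℝ E] [MeasurableSpace E] [BorelSpace E] {μ : Measure E}
    [IsFiniteMeasureOnCompacts μ] {a b lam : ℝ} (ha : 0 < a) (hab : a < b) (hlam : 0 ≤ lam)
    (hHardy : ∀ w : E → ℝ, ContDiff ℝ 1 w → HasCompactSupport w →
      tsupport w ⊆ {x : E | a < ‖x‖ ∧ ‖x‖ < b} →
      lam * ∫ x in {x : E | a < ‖x‖ ∧ ‖x‖ < b}, w x ^ 2 / ‖x‖ ^ 2 ∂μ ≤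
        ∫ x in {x : E | a < ‖x‖ ∧ ‖x‖ < b}, ‖gradient w x‖ ^ 2 ∂μ)
    {u : ℝ → ℝ} (hu : ContDiffOn ℝ 1 u (Icc a b)) (hpos : ∀ r ∈ Ioo a b, 0 < u r)
    (hua : u a = 0) (hub : u b = 0) :
    lam * ∫ x in {x : E | a < ‖x‖ ∧ ‖x‖ < b}, u ‖x‖ ^ 2 / ‖x‖ ^ 2 ∂μ ≤
      ∫ x in {x : E | a < ‖x‖ ∧ ‖x‖ < b}, derivWithin u (Icc a b) ‖x‖ ^ 2 ∂μ := by
  set Ω := {x : E | a < ‖x‖ ∧ ‖x‖ < b} with hΩ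
  have hΩo : IsOpen Ω := isOpen_Ioo.preimage continuous_norm
  have hne (x) (hx : x ∈ {x : E | ‖x‖ ∈ Icc a b}) : ‖x‖ ^ 2 ≠ 0 :=
    pow_ne_zero 2 (ha.trans_le hx.1).ne'
  have hc := hu.continuousOn.comp_norm (E := E)
  have hc' := (hu.continuousOn_derivWithin (uniqueDiffOn_Icc hab) le_rfl).comp_norm (E := E)
  set A := ∫ x in Ω, u ‖x‖ ^ 2 / ‖x‖ ^ 2 ∂μ
  set B := ∫ x in Ω, u ‖x‖ / ‖x‖ ^ 2 ∂μ
  have iA : IntegrableOn (fun x => u ‖x‖ ^ 2 / ‖x‖ ^ 2) Ω μ :=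
    ((hc.pow 2).div (by fun_prop) hne).integrableOn_annulus
  have iB : IntegrableOn (fun x => u ‖x‖ / ‖x‖ ^ 2) Ω μ :=
    (hc.div (by fun_prop) hne).integrableOn_annulus
  have iD : IntegrableOn (fun x => derivWithin u (Icc a b) ‖x‖ ^ 2) Ω μ :=
    ContinuousOn.integrableOn_annulus (by fun_prop)
  have key (ε : ℝ) (hε : 0 < ε) : lam * (A - 4 * ε * B) ≤
      ∫ x in Ω, derivWithin u (Icc a b) ‖x‖ ^ 2 ∂μ := by
    set w : E → ℝ := fun x => if x ∈ Ω then smoothShrink ε (u ‖x‖) else 0 with hw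
    have hwΩ (x) (hx : x ∈ Ω) : w =ᶠ[nhds x] fun x => (smoothShrink ε ∘ u) ‖x‖ := by
      filter_upwards [hΩo.mem_nhds hx] with y hy using if_pos hy
    set K := {x : E | ‖x‖ ∈ Icc a b} ∩ (fun x => u ‖x‖) ⁻¹' Ici ε
    have hKc : IsClosed K :=
      hc.preimage_isClosed_of_isClosed (isClosed_Icc.preimage continuous_norm) isClosed_Ici
    have hK : IsCompact K := (isCompact_closedBall (0 : E) b).of_isClosed_subset hKc
      fun x hx => by simpa using hx.1.2
    have hKΩ : K ⊆ Ω := fun x hx => by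
      have h1 : ε ≤ u ‖x‖ := hx.2
      refine ⟨hx.1.1.lt_of_ne fun h => ?_, hx.1.2.lt_of_ne fun h => ?_⟩
      · rw [← h, hua] at h1; linarith
      · rw [h, hub] at h1; linarith
    have hsupp : tsupport w ⊆ K := by
      refine closure_minimal (fun x hx => ?_) hKc
      by_cases hxΩ : x ∈ Ω
      · refine ⟨⟨hxΩ.1.le, hxΩ.2.le⟩, ?_⟩
        by_contra hlt
        exact hx (by simp only [hw, if_pos hxΩ]; exact smoothShrink_eq_zero hε (not_le.1 hlt).le)
      · exact absurd (if_neg hxΩ) hx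
    have hwC : ContDiff ℝ 1 w := by
      refine contDiff_iff_contDiffAt.2 fun x => ?_
      by_cases hx : x ∈ Ω
      · refine ContDiffAt.congr_of_eventuallyEq ?_ (hwΩ x hx)
        have h0 : x ≠ 0 := norm_pos_iff.1 (ha.trans hx.1)
        exact contDiff_smoothShrink.contDiffAt.comp x
          ((hu.contDiffAt (Icc_mem_nhds hx.1 hx.2)).comp x (contDiffAt_norm ℝ h0))
      · exact contDiffAt_const.congr_of_eventuallyEq
          (notMem_tsupport_iff_eventuallyEq.1 fun h => hx (hKΩ (hsupp h)))
    have h1 := hHardy w hwC (hK.of_isClosed_subset (isClosed_tsupport w) hsupp) (hsupp.trans hKΩ)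
    have iw : IntegrableOn (fun x => w x ^ 2 / ‖x‖ ^ 2) Ω μ :=
      ((hwC.continuous.continuousOn.pow 2).div (by fun_prop) hne).integrableOn_annulus
    have h2 : ∫ x in Ω, ‖gradient w x‖ ^ 2 ∂μ ≤ ∫ x in Ω, derivWithin u (Icc a b) ‖x‖ ^ 2 ∂μ := by
      refine integral_mono_of_nonneg (.of_forall fun _ => sq_nonneg _) iD ?_
      filter_upwards [ae_restrict_mem hΩo.measurableSet] with x hx
      have h0 : x ≠ 0 := norm_pos_iff.1 (ha.trans hx.1)
      have hd := (hasDerivAt_smoothShrink (ε := ε) (u ‖x‖)).comp ‖x‖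
        (hu.hasDerivAt_derivWithin_Icc hx)
      have hg : gradient w x = gradient (fun x => (smoothShrink ε ∘ u) ‖x‖) x := by
        unfold gradient
        rw [(hwΩ x hx).fderiv_eq]
      rw [hg, norm_sq_gradient_radial h0 hd, mul_pow]
      refine mul_le_of_le_one_left (sq_nonneg _) (pow_le_one₀ (le_max_left _ _) ?_)
      exact max_le zero_le_one (min_le_left _ _)
    have h3 : A - 4 * ε * B ≤ ∫ x in Ω, w x ^ 2 / ‖x‖ ^ 2 ∂μ := by
      rw [← integral_const_mul, ← integral_sub iA (iB.const_mul _)]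
      refine setIntegral_mono_on (iA.sub (iB.const_mul _)) iw hΩo.measurableSet fun x hx => ?_
      have hup := hpos _ hx
      have hs1 := sub_le_smoothShrink hε hup.le
      have hs2 := smoothShrink_nonneg (ε := ε) hup.le
      have hr : 0 < ‖x‖ := ha.trans hx.1
      simp only [hw, if_pos hx]
      rw [← mul_div_assoc, ← sub_div]
      gcongr
      rcases le_total (u ‖x‖) (2 * ε) with h | h
      · nlinarith
      · nlinarith
    exact (mul_le_mul_of_nonneg_left h3 hlam).trans (h1.trans h2)
  refine le_of_forall_pos_le_add fun δ hδ => ?_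
  have hB : 0 < 4 * lam * |B| + 1 := by positivity
  have h := key (δ / (4 * lam * |B| + 1)) (by positivity)
  have h4 : lam * (4 * (δ / (4 * lam * |B| + 1)) * B) ≤ δ := by
    calc _ = δ * ((4 * lam * B) / (4 * lam * |B| + 1)) := by ring
      _ ≤ δ * 1 := by
        gcongr
        rw [div_le_one hB]
        nlinarith [le_abs_self B]
      _ = δ := mul_one δ
  linarith

theorem sum_block_coefficients {N m n : ℕ} (hm : 1 ≤ m) (hmn : m + n = N) :
    ∑ i : Fin N, (((m : ℝ) - n) / N - if (i : ℕ) < m then 1 else -1) = 0 := by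
  subst hmn
  have : ((m : ℝ) + n) ≠ 0 := by positivity
  rw [Fin.sum_univ_add]
  simp
  field_simp
  ring

/-- Symmetry breaking: let `u` be a positive radial solution of `-Δu = a(|x|)u^{p-1}` on
the annulus `Ω = {R₁ < |x| < R₂} ⊆ ℝᴺ` with zero Dirichlet data, `λ₁` the optimal Hardy
constant on `Ω`, `ψ(θ) = (m-n)/N - cos 2θ` (with `m + n = N`) and `v = u(r)ψ(θ)`, where
`cos 2θ = (s² - t²)/r²` in the block coordinates `s = |(x₁,…,x_m)|`,
`t = |(x_{m+1},…,x_N)|`. If `p - 2 > 2N/λ₁`, then the second variation quadratic form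
`M(u,v) = ∫_Ω |∇v|² - (p-1)∫_Ω a u^{p-2} v²` is strictly negative. -/
theorem stmt_19 (N m n : ℕ) (hN : 3 ≤ N) (hm : 1 ≤ m) (hn : 1 ≤ n) (hmn : m + n = N)
    (R₁ R₂ : ℝ) (hR₁ : 0 < R₁) (hR : R₁ < R₂)
    (Ω : Set (EuclideanSpace ℝ (Fin N)))
    (hΩ : Ω = {x : EuclideanSpace ℝ (Fin N) | R₁ < ‖x‖ ∧ ‖x‖ < R₂})
    (p : ℝ) (hp : 2 < p)
    (a : ℝ → ℝ) (ha : ContinuousOn a (Icc R₁ R₂)) (ha0 : ∀ r ∈ Icc R₁ R₂, 0 ≤ a r)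
    -- `u` is a positive radial classical solution with zero boundary values:
    (u : ℝ → ℝ) (hreg : ContDiffOn ℝ 2 u (Icc R₁ R₂))
    (hupos : ∀ r ∈ Ioo R₁ R₂, 0 < u r) (hu1 : u R₁ = 0) (hu2 : u R₂ = 0)
    (hODE : ∀ r ∈ Ioo R₁ R₂,
      -(deriv (deriv u) r) - ((N : ℝ) - 1) / r * deriv u r = a r * u r ^ (p - 1))
    -- `λ₁` is the optimal Hardy constant on `Ω`:
    (lam₁ : ℝ) (hlam₁pos : 0 < lam₁)
    (hHardy : ∀ w : EuclideanSpace ℝ (Fin N) → ℝ, ContDiff ℝ 1 w → HasCompactSupport w →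
      tsupport w ⊆ Ω →
      lam₁ * ∫ x in Ω, w x ^ 2 / ‖x‖ ^ 2 ≤ ∫ x in Ω, ‖gradient w x‖ ^ 2)
    -- condition for symmetry breaking:
    (hcond : p - 2 > 2 * (N : ℝ) / lam₁)
    -- the test direction `v = u(r) ψ(θ)`:
    (v : EuclideanSpace ℝ (Fin N) → ℝ)
    (hv : ∀ x : EuclideanSpace ℝ (Fin N),
      v x = u ‖x‖ * (((m : ℝ) - n) / N -
        ((∑ i : Fin N, if (i : ℕ) < m then x i ^ 2 else 0) -
          ∑ i : Fin N, if m ≤ (i : ℕ) then x i ^ 2 else 0) / ‖x‖ ^ 2)) :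
    (∫ x in Ω, ‖gradient v x‖ ^ 2) -
      (p - 1) * ∫ x in Ω, a ‖x‖ * u ‖x‖ ^ (p - 2) * v x ^ 2 < 0 := by
  subst hΩ
  have hNpos : 0 < N := by omega
  have : Nonempty (Fin N) := ⟨⟨0, hNpos⟩⟩
  have hN0 : (N : ℝ) ≠ 0 := by positivity
  set Ω := {x : EuclideanSpace ℝ (Fin N) | R₁ < ‖x‖ ∧ ‖x‖ < R₂} with hΩ
  have hΩo : IsOpen Ω := isOpen_Ioo.preimage continuous_norm
  set c : Fin N → ℝ := fun i => ((m : ℝ) - n) / N - if (i : ℕ) < m then 1 else -1 with hcdef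
  have hcsum : ∑ i, c i = 0 := sum_block_coefficients hm hmn
  have hc0 : c ⟨0, hNpos⟩ ≠ 0 := by
    have h1 : (n : ℝ) ≠ 0 := by positivity
    have h2 : (m : ℝ) - n ≠ N := by
      rw [← hmn]; push_cast
      intro h
      exact h1 (by linarith)
    simp only [hcdef, if_pos (show 0 < m from hm)]
    rwa [sub_ne_zero, ne_eq, div_eq_one_iff_eq hN0]
  have hv' (x : EuclideanSpace ℝ (Fin N)) (hx : x ≠ 0) :
      v x = u ‖x‖ * ((∑ i, c i * x i ^ 2) / ‖x‖ ^ 2) := by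
    have hr := norm_ne_zero_iff.2 hx
    rw [hv, ← Finset.sum_sub_distrib, eq_comm]
    congr 1
    rw [div_eq_iff (pow_ne_zero 2 hr), sub_mul, div_mul_cancel₀ _ (pow_ne_zero 2 hr),
      EuclideanSpace.real_norm_sq_eq, Finset.mul_sum, ← Finset.sum_sub_distrib]
    refine Finset.sum_congr rfl fun i _ => ?_
    by_cases hi : (i : ℕ) < m
    · simp [hcdef, hi, not_le.2 hi]; ring
    · simp [hcdef, hi, not_lt.1 hi]; ring
  set u' := derivWithin u (Icc R₁ R₂)
  have huC : ContDiffOn ℝ 1 u (Icc R₁ R₂) := hreg.of_le one_le_two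
  have huc := huC.continuousOn
  have huc' : ContinuousOn u' (Icc R₁ R₂) :=
    huC.continuousOn_derivWithin (uniqueDiffOn_Icc hR) le_rfl
  have hupow : ContinuousOn (fun r => u r ^ (p - 1)) (Icc R₁ R₂) :=
    huc.rpow_const fun _ _ => Or.inr (by linarith)
  set σ := (volume : Measure (EuclideanSpace ℝ (Fin N))).toSphere
  set Q := ∫ ω : Metric.sphere (0 : EuclideanSpace ℝ (Fin N)) 1,
    (∑ i, c i * (ω : EuclideanSpace ℝ (Fin N)) i ^ 2) ^ 2 ∂σ with hQ
  set S := ∫ ω : Metric.sphere (0 : EuclideanSpace ℝ (Fin N)) 1,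
    (∑ i, c i ^ 2 * (ω : EuclideanSpace ℝ (Fin N)) i ^ 2) ∂σ
  have hQpos : 0 < Q := integral_sphere_sq_sum_mul_sq_pos c hc0
  have hSQ : 2 * S = (N + 2) * Q := by
    simpa using integral_sphere_sum_sq_mul_sq c hcsum
  set D := ∫ r in Ioo R₁ R₂, r ^ (N - 1) * u' r ^ 2
  set H := ∫ r in Ioo R₁ R₂, r ^ (N - 1) * (u r ^ 2 / r ^ 2) with hH
  have hpolar (F : ℝ → ℝ) (g : EuclideanSpace ℝ (Fin N) → ℝ) : ∫ x in Ω, F ‖x‖ * g (‖x‖⁻¹ • x) =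
      (∫ r in Ioo R₁ R₂, r ^ (N - 1) * F r) *
        ∫ ω : Metric.sphere (0 : EuclideanSpace ℝ (Fin N)) 1, g ω ∂σ := by
    rw [hΩ, setIntegral_annulus_radial_mul_angular volume hR₁ F g, finrank_euclideanSpace,
      Fintype.card_fin]
  have hint (F : ℝ → ℝ) (g : EuclideanSpace ℝ (Fin N) → ℝ)
      (hF : ContinuousOn F (Icc R₁ R₂)) (hg : Continuous g) :
      IntegrableOn (fun x => F ‖x‖ * g (‖x‖⁻¹ • x)) Ω := by
    refine ContinuousOn.integrableOn_annulus (hF.comp_norm.mul (hg.comp_continuousOn ?_))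
    exact (continuous_norm.continuousOn.inv₀ fun x hx => (hR₁.trans_le hx.1).ne').smul
      continuousOn_id
  have hne (r) (hr : r ∈ Icc R₁ R₂) : r ^ 2 ≠ 0 := pow_ne_zero 2 (hR₁.trans_le hr.1).ne'
  have hHc : ContinuousOn (fun r => u r ^ 2 / r ^ 2) (Icc R₁ R₂) :=
    (huc.pow 2).div (by fun_prop) hne
  have henergy : D = ∫ r in Ioo R₁ R₂, r ^ (N - 1) * (a r * u r ^ (p - 1) * u r) := by
    refine integral_pow_mul_derivWithin_sq hR₁ hR hreg (ha.mul hupow) hu1 hu2 fun r hr => ?_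
    rw [Nat.cast_pred hNpos]
    exact hODE r hr
  have hgrad : ∫ x in Ω, ‖gradient v x‖ ^ 2 = D * Q + H * (4 * S - 4 * Q) := by
    have hpt (x) (hx : x ∈ Ω) : ‖gradient v x‖ ^ 2 =
        u' ‖x‖ ^ 2 * (∑ i, c i * (‖x‖⁻¹ • x) i ^ 2) ^ 2 + u ‖x‖ ^ 2 / ‖x‖ ^ 2 *
        (4 * ∑ i, c i ^ 2 * (‖x‖⁻¹ • x) i ^ 2 - 4 * (∑ i, c i * (‖x‖⁻¹ • x) i ^ 2) ^ 2) := by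
      have h0 : x ≠ 0 := norm_pos_iff.1 (hR₁.trans hx.1)
      rw [← norm_sq_gradient_radial_mul_angular c h0 (huC.hasDerivAt_derivWithin_Icc hx)]
      have : v =ᶠ[nhds x] fun y => u ‖y‖ * ((∑ i, c i * y i ^ 2) / ‖y‖ ^ 2) := by
        filter_upwards [isOpen_ne.mem_nhds h0] with y hy using hv' y hy
      unfold gradient
      rw [this.fderiv_eq]
    rw [setIntegral_congr_fun hΩo.measurableSet hpt, integral_add
      (hint (fun r => u' r ^ 2) (fun y : EuclideanSpace ℝ (Fin N) => (∑ i, c i * y i ^ 2) ^ 2)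
        (huc'.pow 2) (by fun_prop))
      (hint (fun r => u r ^ 2 / r ^ 2)
        (fun y : EuclideanSpace ℝ (Fin N) =>
          4 * ∑ i, c i ^ 2 * y i ^ 2 - 4 * (∑ i, c i * y i ^ 2) ^ 2) hHc (by fun_prop)),
      hpolar (fun r => u' r ^ 2) (fun y : EuclideanSpace ℝ (Fin N) => (∑ i, c i * y i ^ 2) ^ 2),
      hpolar (fun r => u r ^ 2 / r ^ 2)
        (fun y : EuclideanSpace ℝ (Fin N) =>
          4 * ∑ i, c i ^ 2 * y i ^ 2 - 4 * (∑ i, c i * y i ^ 2) ^ 2)]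
    have hcont {g : Metric.sphere (0 : EuclideanSpace ℝ (Fin N)) 1 → ℝ} (hg : Continuous g) :
        Integrable g σ :=
      hg.integrable_of_hasCompactSupport (.of_compactSpace _)
    rw [integral_sub (hcont (by fun_prop)) (hcont (by fun_prop)), integral_const_mul,
      integral_const_mul]
  have hpot : ∫ x in Ω, a ‖x‖ * u ‖x‖ ^ (p - 2) * v x ^ 2 = D * Q := by
    rw [henergy, hQ, ← hpolar (fun r => a r * u r ^ (p - 1) * u r)
      (fun y : EuclideanSpace ℝ (Fin N) => (∑ i, c i * y i ^ 2) ^ 2)]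
    refine setIntegral_congr_fun hΩo.measurableSet fun x hx => ?_
    have hr : 0 < ‖x‖ := hR₁.trans hx.1
    have h1 : u ‖x‖ ^ (p - 1) = u ‖x‖ ^ (p - 2) * u ‖x‖ := by
      rw [← rpow_add_one (hupos _ hx).ne']
      congr 1; ring
    simp only [hv' x (norm_pos_iff.1 hr), sum_mul_sq_smul, h1]
    field_simp
  have hHardy1 : lam₁ * H ≤ D := by
    have h := hardy_radial hR₁ hR hlam₁pos.le hHardy huC hupos hu1 hu2
    have e1 := hpolar (fun r => u r ^ 2 / r ^ 2) fun _ => 1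
    have e2 := hpolar (fun r => u' r ^ 2) fun _ => 1
    simp only [mul_one] at e1 e2
    rw [e1, e2, ← mul_assoc] at h
    refine le_of_mul_le_mul_right h ?_
    have : Nonempty (Metric.sphere (0 : EuclideanSpace ℝ (Fin N)) 1) :=
      ⟨⟨EuclideanSpace.single ⟨0, hNpos⟩ 1, by simp⟩⟩
    simp only [integral_const, smul_eq_mul, mul_one]
    exact measureReal_univ_pos
  have hHpos : 0 < H := by
    rw [hH, setIntegral_pos_iff_support_of_nonneg_ae]
    · rw [inter_eq_right.2]
      · simpa using hR
      · intro r hr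
        have h1 := hupos r hr
        have h2 := hR₁.trans hr.1
        exact (by positivity : r ^ (N - 1) * (u r ^ 2 / r ^ 2) ≠ 0)
    · filter_upwards [ae_restrict_mem measurableSet_Ioo] with r hr
      have h2 := hR₁.trans hr.1
      simp only [Pi.zero_apply]
      positivity
    · exact (ContinuousOn.integrableOn_Icc (by fun_prop)).mono_set Ioo_subset_Icc_self
  have hcond' : 2 * (N : ℝ) < (p - 2) * lam₁ := (div_lt_iff₀ hlam₁pos).1 hcond
  rw [hgrad, hpot]
  have h1 : 2 * N * H < (p - 2) * D := by
    calc 2 * N * H < (p - 2) * lam₁ * H := by gcongr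
      _ = (p - 2) * (lam₁ * H) := by ring
      _ ≤ _ := mul_le_mul_of_nonneg_left hHardy1 (by linarith)
  have h2 : D * Q + H * (4 * S - 4 * Q) - (p - 1) * (D * Q) = (2 * N * H - (p - 2) * D) * Q := by
    linear_combination 2 * H * hSQ
  rw [h2]
  exact mul_neg_of_neg_of_pos (by linarith) hQpos
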